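/- arXiv:1406.4952 — 3 statements merged into one kernel-verified Lean document; each statement's English description precedes it below -/
import Mathlib

section
/- Let f₁, f₂, f₃, h₁, h₂, h₃ be real numbers and set A₁ := f₂h₃ − f₃h₂, A₂ := f₃h₁ − f₁h₃, A₃ := f₁h₂ − f₂h₁. Assume A₁ > 0, A₂ > 0, A₃ > 0, and set D := A₁ + A₂ + A₃ (so D > 0). Let r₁, r₂, r₃ be real numbers with rⱼ > 0 for j = 1,2,3, and define the along-track error δu := ((h₂ − h₃)r₁ + (h₃ − h₁)r₂ + (h₁ − h₂)r₃)/D and the clock-bias error δb := (A₁ r₁ + A₂ r₂ + A₃ r₃)/D. Then |δu| ≤ M_u · |δb|, where M_u := max(|h₂ − h₃|, |h₃ − h₁|, |h₁ − h₂|) / min(A₁, A₂, A₃). -/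
/-- Upper bound of the along-track error by the clock-bias error: under the
satellite-configuration conditions `A₁, A₂, A₃ > 0` and positive residuals
`rⱼ > 0`, the along-track error `δu` satisfies `|δu| ≤ M_u |δb|`. -/
theorem along_track_error_bound (f₁ f₂ f₃ h₁ h₂ h₃ : ℝ)
    (A₁ A₂ A₃ : ℝ)
    (hA₁ : A₁ = f₂*h₃ - f₃*h₂) (hA₂ : A₂ = f₃*h₁ - f₁*h₃) (hA₃ : A₃ = f₁*h₂ - f₂*h₁)
    (hA₁pos : 0 < A₁) (hA₂pos : 0 < A₂) (hA₃pos : 0 < A₃)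
    (D : ℝ) (hD : D = A₁ + A₂ + A₃)
    (r₁ r₂ r₃ : ℝ) (hr₁ : 0 < r₁) (hr₂ : 0 < r₂) (hr₃ : 0 < r₃)
    (δu : ℝ) (hδu : δu = ((h₂ - h₃)*r₁ + (h₃ - h₁)*r₂ + (h₁ - h₂)*r₃) / D)
    (δb : ℝ) (hδb : δb = (A₁*r₁ + A₂*r₂ + A₃*r₃) / D)
    (Mu : ℝ)
    (hMu : Mu = max (|h₂ - h₃|) (max (|h₃ - h₁|) (|h₁ - h₂|)) / min A₁ (min A₂ A₃)) :
    |δu| ≤ Mu * |δb| := by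
  have hDpos : 0 < D := by rw [hD]; positivity
  have hS : 0 < A₁ * r₁ + A₂ * r₂ + A₃ * r₃ := by positivity
  rw [hδu, hδb, hMu, abs_div, abs_div, abs_of_pos hDpos, abs_of_pos hS, ← mul_div_assoc]
  refine div_le_div_of_nonneg_right ?_ hDpos.le
  set M := max (|h₂ - h₃|) (max (|h₃ - h₁|) (|h₁ - h₂|))
  set m := min A₁ (min A₂ A₃)
  have hM₁ : |h₂ - h₃| ≤ M := le_max_left _ _
  have hM₂ : |h₃ - h₁| ≤ M := (le_max_left _ _).trans (le_max_right _ _)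
  have hM₃ : |h₁ - h₂| ≤ M := (le_max_right _ _).trans (le_max_right _ _)
  have hM : 0 ≤ M := (abs_nonneg _).trans hM₁
  have hm : 0 < m := lt_min hA₁pos (lt_min hA₂pos hA₃pos)
  have hm₁ : m ≤ A₁ := min_le_left _ _
  have hm₂ : m ≤ A₂ := (min_le_right _ _).trans (min_le_left _ _)
  have hm₃ : m ≤ A₃ := (min_le_right _ _).trans (min_le_right _ _)
  calc |(h₂ - h₃) * r₁ + (h₃ - h₁) * r₂ + (h₁ - h₂) * r₃|
      ≤ |(h₂ - h₃) * r₁| + |(h₃ - h₁) * r₂| + |(h₁ - h₂) * r₃| := abs_add_three _ _ _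
    _ = |h₂ - h₃| * r₁ + |h₃ - h₁| * r₂ + |h₁ - h₂| * r₃ := by
      rw [abs_mul, abs_mul, abs_mul, abs_of_pos hr₁, abs_of_pos hr₂, abs_of_pos hr₃]
    _ ≤ M * r₁ + M * r₂ + M * r₃ := by gcongr
    _ = M / m * (m * r₁ + m * r₂ + m * r₃) := by field_simp
    _ ≤ M / m * (A₁ * r₁ + A₂ * r₂ + A₃ * r₃) := by gcongr
end

section
/- Let f₁, f₂, f₃, h₁, h₂, h₃ be real numbers and set A₁ := f₂h₃ − f₃h₂, A₂ := f₃h₁ − f₁h₃, A₃ := f₁h₂ − f₂h₁. Assume A₁ > 0, A₂ > 0, A₃ > 0, and set D := A₁ + A₂ + A₃ (so D > 0). Let r₁, r₂, r₃ be real numbers with rⱼ > 0 for j = 1,2,3, and define the cross-track error δv := ((f₃ − f₂)r₁ + (f₁ − f₃)r₂ + (f₂ − f₁)r₃)/D and the clock-bias error δb := (A₁ r₁ + A₂ r₂ + A₃ r₃)/D. Then |δv| ≤ M_v · |δb|, where M_v := max(|f₂ − f₃|, |f₃ − f₁|, |f₁ − f₂|) / min(A₁, A₂, A₃). -/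
/-- Upper bound of the cross-track error by the clock-bias error: under the
satellite-configuration conditions `A₁, A₂, A₃ > 0` and positive residuals
`rⱼ > 0`, the cross-track error `δv` satisfies `|δv| ≤ M_v |δb|`. -/
theorem cross_track_error_bound (f₁ f₂ f₃ h₁ h₂ h₃ : ℝ)
    (A₁ A₂ A₃ : ℝ)
    (hA₁ : A₁ = f₂*h₃ - f₃*h₂) (hA₂ : A₂ = f₃*h₁ - f₁*h₃) (hA₃ : A₃ = f₁*h₂ - f₂*h₁)
    (hA₁pos : 0 < A₁) (hA₂pos : 0 < A₂) (hA₃pos : 0 < A₃)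
    (D : ℝ) (hD : D = A₁ + A₂ + A₃)
    (r₁ r₂ r₃ : ℝ) (hr₁ : 0 < r₁) (hr₂ : 0 < r₂) (hr₃ : 0 < r₃)
    (δv : ℝ) (hδv : δv = ((f₃ - f₂)*r₁ + (f₁ - f₃)*r₂ + (f₂ - f₁)*r₃) / D)
    (δb : ℝ) (hδb : δb = (A₁*r₁ + A₂*r₂ + A₃*r₃) / D)
    (Mv : ℝ)
    (hMv : Mv = max (|f₂ - f₃|) (max (|f₃ - f₁|) (|f₁ - f₂|)) / min A₁ (min A₂ A₃)) :
    |δv| ≤ Mv * |δb| := by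
  have hD_pos : 0 < D := by rw [hD]; positivity
  set F := max (|f₂ - f₃|) (max (|f₃ - f₁|) (|f₁ - f₂|)) with hF
  set m := min A₁ (min A₂ A₃) with hm
  have hm_pos : 0 < m := lt_min hA₁pos (lt_min hA₂pos hA₃pos)
  have hF₁ : |f₃ - f₂| ≤ F := by rw [abs_sub_comm, hF]; exact le_max_left _ _
  have hF₂ : |f₁ - f₃| ≤ F := by rw [abs_sub_comm, hF]; simp
  have hF₃ : |f₂ - f₁| ≤ F := by rw [abs_sub_comm, hF]; simp
  have hF_nonneg : 0 ≤ F := (abs_nonneg _).trans hF₁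
  have hm₁ : m ≤ A₁ := min_le_left _ _
  have hm₂ : m ≤ A₂ := (min_le_right _ _).trans (min_le_left _ _)
  have hm₃ : m ≤ A₃ := (min_le_right _ _).trans (min_le_right _ _)
  have hnum : |(f₃ - f₂) * r₁ + (f₁ - f₃) * r₂ + (f₂ - f₁) * r₃| ≤ F * (r₁ + r₂ + r₃) :=
    calc
      _ ≤ |f₃ - f₂| * r₁ + |f₁ - f₃| * r₂ + |f₂ - f₁| * r₃ := by
        simpa only [abs_mul, abs_of_pos hr₁, abs_of_pos hr₂, abs_of_pos hr₃] using
          abs_add_three ((f₃ - f₂) * r₁) ((f₁ - f₃) * r₂) ((f₂ - f₁) * r₃)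
      _ ≤ F * r₁ + F * r₂ + F * r₃ := by gcongr
      _ = F * (r₁ + r₂ + r₃) := by ring
  have hden : r₁ + r₂ + r₃ ≤ (A₁ * r₁ + A₂ * r₂ + A₃ * r₃) / m := by
    rw [le_div_iff₀ hm_pos]
    calc
      (r₁ + r₂ + r₃) * m = m * r₁ + m * r₂ + m * r₃ := by ring
      _ ≤ A₁ * r₁ + A₂ * r₂ + A₃ * r₃ := by gcongr
  have hδb_nonneg : 0 ≤ δb := by rw [hδb]; positivity
  rw [abs_of_nonneg hδb_nonneg, hδv, hδb, hMv, abs_div, abs_of_pos hD_pos, ← mul_div_assoc]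
  gcongr
  calc
    _ ≤ F * (r₁ + r₂ + r₃) := hnum
    _ ≤ F * ((A₁ * r₁ + A₂ * r₂ + A₃ * r₃) / m) := by gcongr
    _ = F / m * (A₁ * r₁ + A₂ * r₂ + A₃ * r₃) := by ring
end

section
/- Let f₁, f₂ be real numbers with f₁ < 0 < f₂ (or symmetrically f₂ < 0 < f₁), so that in particular D' := f₂ − f₁ ≠ 0. Let r₁, r₂ be positive real numbers, and define the along-track error δs := (r₂ − r₁)/D' and the clock-bias error δb := (f₂ r₁ − f₁ r₂)/D'. Then |δs| ≤ M_s · |δb|, where M_s := 1 / min(|f₁|, |f₂|). -/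
/-- The two-satellite along-track bound: if the directional cosines `f₁, f₂`
have opposite signs, the along-track error `δs = (r₂ - r₁)/D'` is bounded by
`M_s |δb|` with `M_s = 1 / min(|f₁|, |f₂|)` for all positive residuals. -/
theorem two_satellite_along_track_bound (f₁ f₂ : ℝ)
    (hsign : (f₁ < 0 ∧ 0 < f₂) ∨ (f₂ < 0 ∧ 0 < f₁))
    (D' : ℝ) (hD' : D' = f₂ - f₁)
    (r₁ r₂ : ℝ) (hr₁ : 0 < r₁) (hr₂ : 0 < r₂)
    (δs : ℝ) (hδs : δs = (r₂ - r₁) / D')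
    (δb : ℝ) (hδb : δb = (f₂*r₁ - f₁*r₂) / D')
    (Ms : ℝ) (hMs : Ms = 1 / min (|f₁|) (|f₂|)) :
    |δs| ≤ Ms * |δb| := by
  have hm : 0 < min |f₁| |f₂| := by
    rcases hsign with ⟨h₁, h₂⟩ | ⟨h₂, h₁⟩
    · exact lt_min (abs_pos.mpr h₁.ne) (abs_pos.mpr h₂.ne')
    · exact lt_min (abs_pos.mpr h₁.ne') (abs_pos.mpr h₂.ne)
  have hnum : |f₂ * r₁ - f₁ * r₂| = |f₂| * r₁ + |f₁| * r₂ := by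
    rcases hsign with ⟨h₁, h₂⟩ | ⟨h₂, h₁⟩
    · rw [abs_of_neg h₁, abs_of_pos h₂, abs_of_pos (by nlinarith)]
      ring
    · rw [abs_of_pos h₁, abs_of_neg h₂, abs_of_neg (by nlinarith)]
      ring
  have hdiff : |r₂ - r₁| ≤ r₁ + r₂ := abs_le.mpr ⟨by linarith, by linarith⟩
  have key : |r₂ - r₁| * min |f₁| |f₂| ≤ |f₂ * r₁ - f₁ * r₂| :=
    calc |r₂ - r₁| * min |f₁| |f₂| ≤ (r₁ + r₂) * min |f₁| |f₂| := by gcongr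
      _ = min |f₁| |f₂| * r₁ + min |f₁| |f₂| * r₂ := by ring
      _ ≤ |f₂| * r₁ + |f₁| * r₂ := by
        gcongr
        · exact min_le_right _ _
        · exact min_le_left _ _
      _ = |f₂ * r₁ - f₁ * r₂| := hnum.symm
  rw [hMs, one_div_mul_eq_div, le_div_iff₀ hm, hδs, hδb, abs_div, abs_div, div_mul_eq_mul_div]
  gcongr
end
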